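/- arXiv:math/0511277 — 5 statements merged into one kernel-verified Lean document; each statement's English description precedes it below -/
import Mathlib

section
/- Let L be a free abelian group of rank 2n with an action of the dihedral group D = ⟨t,u⟩ of order 8 whose central involution acts as -1. Then Tel(t) = L^+(t) ⊕ L^-(t) is a free ℤ⟨u⟩-module, i.e., Tel(t) is a direct sum of copies of the regular module for the group of order 2 generated by u. Consequently, every element of Tel(t) negated by u is of the form v·u - v for some v ∈ Tel(t). -/
/-- The `+1`-eigenlattice of an involution `t` on `L`. -/
def eigP {L : Type*} [AddCommGroup L] (t : Module.End ℤ L) : Submodule ℤ L :=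
  LinearMap.ker (t - 1)

/-- The `-1`-eigenlattice of an involution `t` on `L`. -/
def eigM {L : Type*} [AddCommGroup L] (t : Module.End ℤ L) : Submodule ℤ L :=
  LinearMap.ker (t + 1)

/-- The total eigenlattice `Tel(t) = L^+(t) + L^-(t)`. -/
def Tel {L : Type*} [AddCommGroup L] (t : Module.End ℤ L) : Submodule ℤ L :=
  eigP t ⊔ eigM t

section

variable {L : Type*} [AddCommGroup L]

theorem mem_eigP {t : Module.End ℤ L} {x : L} : x ∈ eigP t ↔ t x = x := by
  simp [eigP, sub_eq_zero]

theorem mem_eigM {t : Module.End ℤ L} {x : L} : x ∈ eigM t ↔ t x = -x := by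
  simp [eigM, add_eq_zero_iff_eq_neg]

theorem eigP_inf_eigM [IsAddTorsionFree L] (t : Module.End ℤ L) : eigP t ⊓ eigM t = ⊥ := by
  refine (Submodule.eq_bot_iff _).2 fun x hx => ?_
  have hp := mem_eigP.1 hx.1
  have hm := mem_eigM.1 hx.2
  exact self_eq_neg.1 (hp.symm.trans hm)

theorem apply_apply_eq_neg_of_mul_mul_self {t u : Module.End ℤ L} (ht : t * t = 1)
    (hu : u * u = 1) (hz : (t * u) * (t * u) = -1) (x : L) : t (u x) = -u (t x) := by
  have h : t * u = -(u * t) := by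
    calc t * u = t * u * (t * u) * (u * t) := by
          rw [show t * u * (t * u) * (u * t) = t * u * (t * (u * u) * t) by
            simp only [mul_assoc], hu, mul_one, ht, mul_one]
      _ = -(u * t) := by rw [hz, neg_one_mul]
  simpa using LinearMap.congr_fun h x

theorem map_eigP_eq_eigM {t u : Module.End ℤ L} (hu : u * u = 1)
    (htu : ∀ x, t (u x) = -u (t x)) : Submodule.map u (eigP t) = eigM t := by
  ext y
  rw [Submodule.mem_map]
  constructor
  · rintro ⟨x, hx, rfl⟩
    rw [mem_eigM, htu, mem_eigP.1 hx]
  · intro hy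
    refine ⟨u y, ?_, LinearMap.congr_fun hu y⟩
    rw [mem_eigP, htu, mem_eigM.1 hy, map_neg, neg_neg]

end

/-- `Tel(t)` is a free `ℤ⟨u⟩`-module: it splits as `S ⊕ S·u` (a direct sum of copies of
the regular module for `⟨u⟩ ≅ C₂`).  Consequently, every element of `Tel(t)` negated by
`u` has the form `v·u - v` for some `v ∈ Tel(t)`. -/
theorem tel_free_zu_module {L : Type*} [AddCommGroup L]
    [Module.Free ℤ L] [Module.Finite ℤ L] (n : ℕ)
    (hrank : Module.finrank ℤ L = 2 * n)
    (t u : Module.End ℤ L) (ht : t * t = 1) (hu : u * u = 1)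
    (hz : (t * u) * (t * u) = -1) :
    (∃ S : Submodule ℤ L,
        S ⊔ Submodule.map u S = Tel t ∧ S ⊓ Submodule.map u S = ⊥) ∧
      ∀ x ∈ Tel t, u x = -x → ∃ v ∈ Tel t, u v - v = x := by
  have : IsAddTorsionFree L := Module.isTorsionFree_int_iff_isAddTorsionFree.1 inferInstance
  have htu := apply_apply_eq_neg_of_mul_mul_self ht hu hz
  have hmap := map_eigP_eq_eigM hu htu
  refine ⟨⟨eigP t, by rw [hmap]; rfl, by rw [hmap, eigP_inf_eigM]⟩, fun x hx hux => ?_⟩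
  obtain ⟨a, ha, b, hb, rfl⟩ := Submodule.mem_sup.1 hx
  have hua : u a ∈ eigM t := hmap ▸ Submodule.mem_map_of_mem ha
  have hub : u b ∈ eigP t := by
    rw [mem_eigP, htu, mem_eigM.1 hb, map_neg, neg_neg]
  rw [map_add] at hux
  have hsum : u a + b = -(u b + a) := by
    rw [← sub_eq_zero] at hux ⊢
    rw [← hux]
    abel
  have hzero : u a + b = 0 := by
    rw [← Submodule.mem_bot ℤ, ← eigP_inf_eigM t]
    exact ⟨hsum ▸ neg_mem (add_mem hub ha), add_mem hua hb⟩
  refine ⟨-a, neg_mem (Submodule.mem_sup_left ha), ?_⟩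
  rw [map_neg, eq_neg_of_add_eq_zero_right hzero]
  abel
end

section
/- Let L be a free abelian group of rank 2n with an action of the dihedral group D = ⟨t,u⟩ of order 8 whose central involution acts as -1. If a coset x + Tel(t) of Tel(t) in L is fixed (setwise) by u, then it contains an element fixed by u. Equivalently: if x·u - x ∈ Tel(t), then there exists v ∈ Tel(t) with (x - v)·u = x - v. -/
/-- The two eigenlattices of an endomorphism of a torsion-free group meet trivially. -/
theorem disjoint_eigP_eigM {L : Type*} [AddCommGroup L] [Module.IsTorsionFree ℤ L]
    (t : Module.End ℤ L) : Disjoint (eigP t) (eigM t) := by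
  rw [Submodule.disjoint_def]
  intro c hP hM
  have hP' : t c - c = 0 := hP
  have hM' : t c + c = 0 := hM
  have h2 : (2 : ℤ) • c = 0 := by
    rw [two_smul]
    calc c + c = (t c + c) - (t c - c) := by abel
      _ = 0 := by rw [hM', hP', sub_zero]
  exact (smul_eq_zero.mp h2).resolve_left two_ne_zero

/-- An endomorphism anticommuting with `t` maps `L^+(t)` into `L^-(t)`. -/
theorem apply_mem_eigM {L : Type*} [AddCommGroup L] {t u : Module.End ℤ L}
    (h : ∀ y, t (u y) = -u (t y)) {a : L} (ha : a ∈ eigP t) : u a ∈ eigM t := by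
  have ha' : t a = a := sub_eq_zero.mp ha
  change t (u a) + u a = 0
  rw [h, ha', neg_add_cancel]

/-- An endomorphism anticommuting with `t` maps `L^-(t)` into `L^+(t)`. -/
theorem apply_mem_eigP {L : Type*} [AddCommGroup L] {t u : Module.End ℤ L}
    (h : ∀ y, t (u y) = -u (t y)) {b : L} (hb : b ∈ eigM t) : u b ∈ eigP t := by
  have hb' : t b = -b := eq_neg_of_add_eq_zero_left hb
  change t (u b) - u b = 0
  rw [h, hb', map_neg, neg_neg, sub_self]

/-- A coset of `Tel(t)` fixed (setwise) by `u` contains an element fixed by `u`: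
if `x·u - x ∈ Tel(t)` then some `x - v` with `v ∈ Tel(t)` is fixed by `u`. -/
theorem coset_fixed_by_u_contains_fixed_point {L : Type*} [AddCommGroup L]
    [Module.Free ℤ L] [Module.Finite ℤ L] (n : ℕ)
    (hrank : Module.finrank ℤ L = 2 * n)
    (t u : Module.End ℤ L) (ht : t * t = 1) (hu : u * u = 1)
    (hz : (t * u) * (t * u) = -1)
    (x : L) (hx : u x - x ∈ Tel t) :
    ∃ v ∈ Tel t, u (x - v) = x - v := by
  have hanti : ∀ y, t (u y) = -u (t y) := fun y => by
    have h1 : t (u (t (u (u (t y))))) = -u (t y) := DFunLike.congr_fun hz (u (t y))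
    have h2 : ∀ z, u (u z) = z := fun z => DFunLike.congr_fun hu z
    have h3 : ∀ z, t (t z) = z := fun z => DFunLike.congr_fun ht z
    rwa [h2, h3] at h1
  obtain ⟨a, ha, b, hb, hab⟩ := Submodule.mem_sup.mp hx
  have huab : u a + u b = x - u x := by
    have h2 : u (u x) = x := DFunLike.congr_fun hu x
    rw [← map_add, hab, map_sub, h2]
  have hsum : b + u a = -(a + u b) := by
    rw [eq_neg_iff_add_eq_zero]
    calc b + u a + (a + u b) = (a + b) + (u a + u b) := by abel
      _ = 0 := by rw [hab, huab]; abel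
  have hM : b + u a ∈ eigM t := add_mem hb (apply_mem_eigM hanti ha)
  have hP : b + u a ∈ eigP t :=
    hsum ▸ neg_mem (add_mem ha (apply_mem_eigP hanti hb))
  have hb_eq : b = -u a := eq_neg_of_add_eq_zero_left
    (Submodule.disjoint_def.mp (disjoint_eigP_eigM t) _ hP hM)
  refine ⟨-a, neg_mem (Submodule.mem_sup_left ha), ?_⟩
  have hux : u x = a + b + x := by rw [hab, sub_add_cancel]
  rw [map_sub, map_neg, hux, hb_eq]
  abel
end

section
/- Let L be a free abelian group of rank 2n with an action of the dihedral group D = ⟨t,u⟩ of order 8 whose central involution acts as -1. Then the kernel of the endomorphism induced by t-1 on L/2Tel(t) is exactly Tel(t)/2Tel(t). In other words, if x ∈ L and x·t - x ∈ 2Tel(t), then x ∈ Tel(t). -/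
/-- The doubled total eigenlattice `2·Tel(t)`. -/
def twoTel {L : Type*} [AddCommGroup L] (t : Module.End ℤ L) : Submodule ℤ L :=
  Submodule.map ((2 : ℤ) • (1 : Module.End ℤ L)) (Tel t)

/-- The kernel of the endomorphism induced by `t - 1` on `L/2Tel(t)` is exactly
`Tel(t)/2Tel(t)`: the preimage of `2Tel(t)` under `t - 1` is `Tel(t)`. -/
theorem ker_induced_t_sub_one {L : Type*} [AddCommGroup L]
    [Module.Free ℤ L] [Module.Finite ℤ L] (n : ℕ)
    (hrank : Module.finrank ℤ L = 2 * n)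
    (t u : Module.End ℤ L) (ht : t * t = 1) (hu : u * u = 1)
    (hz : (t * u) * (t * u) = -1) :
    Submodule.comap (t - 1) (twoTel t) = Tel t := by
  have htt (x : L) : t (t x) = x := LinearMap.congr_fun ht x
  have memP (x : L) : x ∈ eigP t ↔ t x = x := by simp [eigP, sub_eq_zero]
  have memM (x : L) : x ∈ eigM t ↔ t x = -x := by simp [eigM, add_eq_zero_iff_eq_neg]
  ext x
  rw [Submodule.mem_comap]
  constructor
  · rintro ⟨_, hy, hx⟩
    obtain ⟨p, hp, m, hm, rfl⟩ := Submodule.mem_sup.mp hy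
    rw [memP] at hp
    rw [memM] at hm
    have hx : (2 : ℤ) • (p + m) = t x - x := hx
    have h := congrArg t hx
    rw [map_smul, map_add, map_sub, hp, hm, htt] at h
    have h4 : (4 : ℤ) • p = 0 := by linear_combination (norm := module) h + hx
    have hp0 : p = 0 := (smul_eq_zero.mp h4).resolve_left (by norm_num)
    subst hp0
    refine Submodule.mem_sup.mpr ⟨x + m, ?_, -m, ?_, by abel⟩
    · rw [memP, map_add, hm]
      linear_combination (norm := module) -hx
    · exact Submodule.neg_mem _ ((memM m).mpr hm)
  · intro hx
    obtain ⟨p, hp, m, hm, rfl⟩ := Submodule.mem_sup.mp hx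
    refine ⟨-m, Submodule.neg_mem _ (Submodule.mem_sup_right hm), ?_⟩
    rw [memP] at hp
    rw [memM] at hm
    change (2 : ℤ) • (-m) = t (p + m) - (p + m)
    rw [map_add, hp, hm]
    module
end

section
/- Let L be a free abelian group of rank 2n with an action of the dihedral group D = ⟨t,u⟩ of order 8 whose central involution acts as -1, with d, e the numbers of Jordan blocks of sizes 2, 1 for u on L/Tel(t). Let B(t) = (L(t-1)+2Tel(t))/2Tel(t). Then |B(t)| = 2^(2d+e). -/
/-- The commutator module `B(g) = (L(g-1) + 2Tel(t))/2Tel(t)` inside `L/2Tel(t)`. -/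
def Bmod {L : Type*} [AddCommGroup L] (t g : Module.End ℤ L) :
    Submodule ℤ (L ⧸ twoTel t) :=
  Submodule.map (twoTel t).mkQ (LinearMap.range (g - 1))

theorem card_eq_card_ker_mul_card_range {R M N : Type*} [Ring R] [AddCommGroup M] [Module R M]
    [AddCommGroup N] [Module R N] (f : M →ₗ[R] N) :
    Nat.card M = Nat.card (LinearMap.ker f) * Nat.card (LinearMap.range f) := by
  rw [Submodule.card_eq_card_quotient_mul_card (LinearMap.ker f),
    Nat.card_congr f.quotKerEquivRange.toEquiv]

section

variable {L : Type*} [AddCommGroup L] {t u : Module.End ℤ L}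

/-- If `t`, `u` are involutions with `(tu)² = -1`, then they anticommute. -/
theorem apply_apply_eq_neg_of_mul_sq (ht : t * t = 1) (hu : u * u = 1)
    (hz : (t * u) * (t * u) = -1) (x : L) : t (u x) = -u (t x) := by
  have ht' : ∀ y, t (t y) = y := fun y ↦ LinearMap.congr_fun ht y
  have hu' : ∀ y, u (u y) = y := fun y ↦ LinearMap.congr_fun hu y
  have h : t (u (t (u (u (t x))))) = -(u (t x)) := LinearMap.congr_fun hz (u (t x))
  rwa [hu', ht'] at h

/-- An endomorphism anticommuting with `t` swaps the eigenlattices, so it preserves `Tel t`. -/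
theorem tel_le_comap_of_anticommute (h : ∀ x, t (u x) = -u (t x)) :
    Tel t ≤ (Tel t).comap u := by
  refine sup_le (fun x hx ↦ Submodule.mem_sup_right ?_) (fun x hx ↦ Submodule.mem_sup_left ?_)
  · have hx' : t x - x = 0 := hx
    change t (u x) + u x = 0
    rw [h, sub_eq_zero.mp hx', neg_add_cancel]
  · have hx' : t x + x = 0 := hx
    change t (u x) - u x = 0
    rw [h, eq_neg_of_add_eq_zero_left hx', map_neg, neg_neg, sub_self]

/-- The preimage of `2 Tel t` under `t - 1` is `Tel t`. -/
theorem comap_sub_one_twoTel [Module.IsTorsionFree ℤ L] (ht : t * t = 1) :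
    (twoTel t).comap (t - 1) = Tel t := by
  have ht' : ∀ y, t (t y) = y := fun y ↦ LinearMap.congr_fun ht y
  refine le_antisymm ?_ (sup_le (fun x hx ↦ ?_) (fun x hx ↦ ?_))
  · rintro x ⟨y, hy, hxy⟩
    obtain ⟨p, hp, m, hm, rfl⟩ := Submodule.mem_sup.mp hy
    have hp' : t p = p := sub_eq_zero.mp hp
    have hm' : t m = -m := eq_neg_of_add_eq_zero_left hm
    have hxy' : (2 : ℤ) • (p + m) = t x - x := hxy
    have hp0 : p = 0 := by
      have h := congrArg t hxy'
      rw [map_smul, map_add, map_sub, hp', hm', ht'] at h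
      have h4 : (4 : ℤ) • p = 0 := by
        calc (4 : ℤ) • p = (2 : ℤ) • (p + m) + (2 : ℤ) • (p + -m) := by module
          _ = 0 := by rw [h, hxy']; abel
      exact (smul_eq_zero.mp h4).resolve_left (by norm_num)
    rw [hp0, zero_add] at hxy'
    rw [← add_sub_cancel_right x m]
    refine sub_mem (Submodule.mem_sup_left ?_) (Submodule.mem_sup_right hm)
    change t (x + m) - (x + m) = 0
    rw [map_add, hm']
    calc t x + -m - (x + m) = (t x - x) - (2 : ℤ) • m := by module
      _ = 0 := by rw [hxy', sub_self]
  · have hx' : (t - 1) x = 0 := hx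
    rw [Submodule.mem_comap, hx']
    exact zero_mem _
  · have hx' : t x = -x := eq_neg_of_add_eq_zero_left hx
    have h : (t - 1) x = (2 : ℤ) • (-x) := by
      change t x - x = _
      rw [hx']
      module
    rw [Submodule.mem_comap, h]
    exact ⟨-x, neg_mem (Submodule.mem_sup_right hx), rfl⟩

/-- The map `t - 1` induces an isomorphism `L/Tel(t) ≃ B(t)`. -/
theorem card_bmod_self [Module.IsTorsionFree ℤ L] (ht : t * t = 1) :
    Nat.card (Bmod t t) = Nat.card (L ⧸ Tel t) := by
  have hker : LinearMap.ker ((twoTel t).mkQ ∘ₗ (t - 1)) = Tel t := by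
    rw [LinearMap.ker_comp, Submodule.ker_mkQ, comap_sub_one_twoTel ht]
  rw [Bmod, ← LinearMap.range_comp, ← hker]
  exact (Nat.card_congr (LinearMap.quotKerEquivRange _).toEquiv).symm

end

/-- With `d`, `e` the numbers of Jordan blocks of sizes 2, 1 for `u` on `L/Tel(t)`,
the module `B(t) = (L(t-1) + 2Tel(t))/2Tel(t)` has order `2^(2d+e)`. -/
theorem card_bmod_t {L : Type*} [AddCommGroup L]
    [Module.Free ℤ L] [Module.Finite ℤ L] (n d e : ℕ)
    (hrank : Module.finrank ℤ L = 2 * n)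
    (t u : Module.End ℤ L) (ht : t * t = 1) (hu : u * u = 1)
    (hz : (t * u) * (t * u) = -1)
    (hd : Nat.card (Submodule.map (Tel t).mkQ (LinearMap.range (u - 1))) = 2 ^ d)
    (he : Nat.card (Submodule.map (Tel t).mkQ (Submodule.comap (u - 1) (Tel t)))
        = 2 ^ (d + e)) :
    Nat.card (Bmod t t) = 2 ^ (2 * d + e) := by
  have hut : ∀ x, t (u x) = -u (t x) := apply_apply_eq_neg_of_mul_sq ht hu hz
  have hu' : Tel t ≤ (Tel t).comap (u - 1) := fun x hx ↦ by
    rw [Submodule.mem_comap, LinearMap.sub_apply]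
    exact sub_mem (tel_le_comap_of_anticommute hut hx) hx
  rw [card_bmod_self ht, card_eq_card_ker_mul_card_range ((Tel t).mapQ (Tel t) (u - 1) hu'),
    Submodule.ker_mapQ, Submodule.range_mapQ, hd, he]
  ring
end

section
/- Let L be a free abelian group of rank 2n with an action of the dihedral group D = ⟨t,u⟩ of order 8 whose central involution acts as -1. If L = L^+(t) + L^-(t) + L^+(u) (3/4-generation with respect to t, -t=t·(central involution), and u), then L = L^+(t) + L^+(u) (2/4-generation). Hence 2/4-generation and 3/4-generation are equivalent. -/
/-- If `(tu)² = -1`, then `u` maps the `-1`-eigenlattice of `t` into the `+1`-eigenlattice. -/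
theorem apply_mem_eigP_of_mem_eigM {L : Type*} [AddCommGroup L] {t u : Module.End ℤ L}
    (ht : t * t = 1) (hu : u * u = 1) (hz : (t * u) * (t * u) = -1) {x : L}
    (hx : x ∈ eigM t) : u x ∈ eigP t := by
  have hx' : t x = -x := by simpa [eigM, add_eq_zero_iff_eq_neg] using hx
  have htt (y : L) : t (t y) = y := by simpa using LinearMap.congr_fun ht y
  have huu (y : L) : u (u y) = y := by simpa using LinearMap.congr_fun hu y
  have hzx : t (u (t (u x))) = -x := by simpa using LinearMap.congr_fun hz x
  have hfix : u (t (u x)) = x := by rw [← htt (u (t (u x))), hzx, map_neg, hx', neg_neg]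
  have : t (u x) = u x := by rw [← huu (t (u x)), hfix]
  simp [eigP, this]

/-- Since `x = (x + u x) - u x`, the `-1`-eigenlattice of `t` lies in `L^+(t) + L^+(u)`. -/
theorem eigM_le_eigP_sup_eigP {L : Type*} [AddCommGroup L] {t u : Module.End ℤ L}
    (ht : t * t = 1) (hu : u * u = 1) (hz : (t * u) * (t * u) = -1) :
    eigM t ≤ eigP t ⊔ eigP u := by
  intro x hx
  have huu : u (u x) = x := by simpa using LinearMap.congr_fun hu x
  refine Submodule.mem_sup.2 ⟨-u x, neg_mem (apply_mem_eigP_of_mem_eigM ht hu hz hx),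
    x + u x, ?_, by abel⟩
  simp [eigP, huu, add_comm]

/-- 3/4-generation `L = L^+(t) + L^-(t) + L^+(u)` implies 2/4-generation
`L = L^+(t) + L^+(u)`; hence the two properties are equivalent. -/
theorem three_fourths_iff_two_fourths {L : Type*} [AddCommGroup L]
    [Module.Free ℤ L] [Module.Finite ℤ L] (n : ℕ)
    (hrank : Module.finrank ℤ L = 2 * n)
    (t u : Module.End ℤ L) (ht : t * t = 1) (hu : u * u = 1)
    (hz : (t * u) * (t * u) = -1) :
    (eigP t ⊔ eigM t ⊔ eigP u = ⊤ → eigP t ⊔ eigP u = ⊤) ∧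
      (eigP t ⊔ eigM t ⊔ eigP u = ⊤ ↔ eigP t ⊔ eigP u = ⊤) := by
  have h : eigP t ⊔ eigM t ⊔ eigP u = eigP t ⊔ eigP u :=
    le_antisymm
      (sup_le (sup_le le_sup_left (eigM_le_eigP_sup_eigP ht hu hz)) le_sup_right)
      (sup_le_sup_right le_sup_left _)
  rw [h]
  exact ⟨id, Iff.rfl⟩
end
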